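/- arXiv:1103.3253 — 3 statements merged into one kernel-verified Lean document; each statement's English description precedes it below -/
import Mathlib

section
/- For every n ∈ ℕ, the function u_n := A₊ⁿ(e^{−x²/2}) is smooth and satisfies the eigenvalue equation −u_n''(x) + x² u_n(x) = (2n+1) u_n(x) for all x ∈ ℝ; that is, u_n is an eigenfunction of the quantum harmonic oscillator P₀ with eigenvalue 2n+1. -/
/-- The creation operator `A₊ = D_x + ix`, where `D_x = −i d/dx`. -/
noncomputable def Aplus (f : ℝ → ℂ) : ℝ → ℂ :=
  fun x => -Complex.I * deriv f x + Complex.I * (x : ℂ) * f x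

/-- The annihilation operator `A₋ = D_x − ix`, where `D_x = −i d/dx`. -/
noncomputable def Aminus (f : ℝ → ℂ) : ℝ → ℂ :=
  fun x => -Complex.I * deriv f x - Complex.I * (x : ℂ) * f x

/-- The `n`-th harmonic oscillator eigenfunction `u_n = A₊ⁿ(e^{−x²/2})`. -/
noncomputable def uHO (n : ℕ) : ℝ → ℂ :=
  Aplus^[n] (fun x : ℝ => Complex.exp (-(x : ℂ) ^ 2 / 2))

theorem ofReal_hasDerivAt_aux (x : ℝ) : HasDerivAt (fun y : ℝ => (y : ℂ)) 1 x :=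
  Complex.ofRealCLM.hasDerivAt

/-- One application of the creation operator raises the eigenvalue by two. -/
theorem Aplus_step_aux (f : ℝ → ℂ) (c : ℂ) (hf : ContDiff ℝ (⊤ : ℕ∞) f)
    (h : ∀ x : ℝ, -(deriv (deriv f) x) + (x : ℂ) ^ 2 * f x = c * f x) :
    ContDiff ℝ (⊤ : ℕ∞) (Aplus f) ∧
    ∀ x : ℝ, -(deriv (deriv (Aplus f)) x) + (x : ℂ) ^ 2 * Aplus f x
      = (c + 2) * Aplus f x := by
  have hf' : ContDiff ℝ (⊤ : ℕ∞) (deriv f) := (contDiff_infty_iff_deriv.1 hf).2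
  have hx : ContDiff ℝ (⊤ : ℕ∞) (fun y : ℝ => (y : ℂ)) := Complex.ofRealCLM.contDiff
  have d1 : ∀ x, HasDerivAt f (deriv f x) x := fun x =>
    ((contDiff_infty_iff_deriv.1 hf).1 x).hasDerivAt
  have d2 : ∀ x : ℝ, HasDerivAt (deriv f) (((x : ℂ) ^ 2 - c) * f x) x := fun x => by
    have := ((contDiff_infty_iff_deriv.1 hf').1 x).hasDerivAt
    have e : deriv (deriv f) x = ((x : ℂ) ^ 2 - c) * f x := by
      linear_combination -(h x)
    rwa [e] at this
  have g1 : deriv (Aplus f) = fun x : ℝ =>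
      Complex.I * (-((x : ℂ) * x) + (c + 1)) * f x + Complex.I * (x : ℂ) * deriv f x := by
    funext x
    have := ((d2 x).const_mul (-Complex.I)).add
      (((ofReal_hasDerivAt_aux x).const_mul Complex.I).mul (d1 x))
    refine (HasDerivAt.deriv (f := Aplus f) this).trans ?_
    ring
  refine ⟨?_, fun x => ?_⟩
  · exact (contDiff_const.mul hf').add ((contDiff_const.mul hx).mul hf)
  · have X := ofReal_hasDerivAt_aux x
    have := (((((X.mul X).neg.add_const (c + 1)).const_mul Complex.I).mul (d1 x))).add
      ((X.const_mul Complex.I).mul (d2 x))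
    have e := HasDerivAt.deriv (f := fun x : ℝ =>
      Complex.I * (-((x : ℂ) * x) + (c + 1)) * f x + Complex.I * (x : ℂ) * deriv f x) this
    rw [g1, e]
    simp only [Aplus, Pi.mul_apply, Pi.neg_apply]
    ring

/-- `u_n = A₊ⁿ(e^{−x²/2})` is smooth and is an eigenfunction of the
quantum harmonic oscillator `P₀ u = −u'' + x² u` with eigenvalue `2n+1`. -/
theorem harmonic_oscillator_eigenfunction (n : ℕ) :
    ContDiff ℝ (⊤ : ℕ∞) (uHO n) ∧
    ∀ x : ℝ, -(deriv (deriv (uHO n)) x) + (x : ℂ) ^ 2 * uHO n x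
      = (2 * (n : ℂ) + 1) * uHO n x := by
  induction n with
  | zero =>
    have d : ∀ x : ℝ, HasDerivAt (uHO 0) (-((x : ℂ) * uHO 0 x)) x := fun x => by
      have := (((ofReal_hasDerivAt_aux x).pow 2).neg.div_const 2).cexp
      refine HasDerivAt.congr_deriv (f := uHO 0) this ?_
      simp [uHO]
      ring
    have e : deriv (uHO 0) = fun x : ℝ => -((x : ℂ) * uHO 0 x) := funext fun x => (d x).deriv
    refine ⟨?_, fun x => ?_⟩
    · have hx : ContDiff ℝ (⊤ : ℕ∞) (fun y : ℝ => (y : ℂ)) := Complex.ofRealCLM.contDiff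
      exact (((hx.pow 2).neg).div_const 2).cexp
    · have := ((ofReal_hasDerivAt_aux x).mul (d x)).neg
      have e2 := HasDerivAt.deriv (f := fun x : ℝ => -((x : ℂ) * uHO 0 x)) this
      rw [e, e2]
      push_cast
      ring
  | succ n ih =>
    have s := Aplus_step_aux (uHO n) _ ih.1 ih.2
    have e : uHO (n + 1) = Aplus (uHO n) := Function.iterate_succ_apply' _ _ _
    rw [e]
    refine ⟨s.1, fun x => ?_⟩
    rw [s.2 x]
    push_cast
    ring
end

section
/- The harmonic oscillator eigenfunctions u_n = A₊ⁿ(e^{−x²/2}), n ∈ ℕ, form a complete orthogonal family in L²(ℝ; ℂ): ⟨u_m, u_n⟩_{L²} = 0 whenever m ≠ n, each u_n is nonzero, and the closure of the linear span of {u_n : n ∈ ℕ} is all of L²(ℝ; ℂ). In particular, after normalization they form a Hilbert basis of L²(ℝ; ℂ). -/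
open MeasureTheory

open Polynomial in
/-- The polynomial factor of `uHO n`. -/
noncomputable def polyHO : ℕ → Polynomial ℂ
  | 0 => 1
  | n + 1 => C Complex.I * (C 2 * (X * polyHO n) - derivative (polyHO n))

/-- The Gaussian weight. -/
noncomputable def gaussHO (x : ℝ) : ℂ := Complex.exp (-(x : ℂ) ^ 2 / 2)

lemma gaussHO_hasDerivAt (x : ℝ) : HasDerivAt gaussHO (-(x : ℂ) * gaussHO x) x := by
  have h : HasDerivAt (fun z : ℂ => Complex.exp (-z ^ 2 / 2))
      (Complex.exp (-(x : ℂ) ^ 2 / 2) * (-(2 * (x : ℂ)) / 2)) (x : ℂ) := by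
    have h1 : HasDerivAt (fun z : ℂ => -z ^ 2 / 2) (-(2 * (x : ℂ)) / 2) (x : ℂ) := by
      simpa using ((hasDerivAt_pow 2 (x : ℂ)).neg.div_const 2)
    exact h1.cexp
  have h2 := h.comp_ofReal
  unfold gaussHO
  convert h2 using 1
  ring

lemma gaussHO_continuous : Continuous gaussHO := by
  unfold gaussHO; fun_prop

lemma norm_gaussHO (x : ℝ) : ‖gaussHO x‖ = Real.exp (-x ^ 2 / 2) := by
  have : (-(x : ℂ) ^ 2 / 2) = ((-x ^ 2 / 2 : ℝ) : ℂ) := by push_cast; ring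
  rw [gaussHO, this, Complex.norm_exp_ofReal]

lemma gaussHO_ne_zero (x : ℝ) : gaussHO x ≠ 0 := Complex.exp_ne_zero _

lemma conj_gaussHO (x : ℝ) : (starRingEnd ℂ) (gaussHO x) = gaussHO x := by
  have : (-(x : ℂ) ^ 2 / 2) = ((-x ^ 2 / 2 : ℝ) : ℂ) := by push_cast; ring
  rw [gaussHO, ← Complex.exp_conj, this, Complex.conj_ofReal]

lemma poly_hasDerivAt (p : Polynomial ℂ) (x : ℝ) :
    HasDerivAt (fun y : ℝ => p.eval (y : ℂ)) (p.derivative.eval (x : ℂ)) x :=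
  (p.hasDerivAt (x : ℂ)).comp_ofReal

lemma poly_continuous (p : Polynomial ℂ) : Continuous (fun y : ℝ => p.eval (y : ℂ)) :=
  p.continuous.comp Complex.continuous_ofReal

lemma uHO_eq (n : ℕ) : uHO n = fun x : ℝ => (polyHO n).eval (x : ℂ) * gaussHO x := by
  induction n with
  | zero => funext x; simp [uHO, polyHO, gaussHO]
  | succ n ih =>
    have : uHO (n + 1) = Aplus (uHO n) := by
      simp only [uHO, Function.iterate_succ_apply']
    rw [this, ih]
    funext x
    have h := ((poly_hasDerivAt (polyHO n) x).mul (gaussHO_hasDerivAt x)).deriv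
    have h' : deriv (fun x : ℝ => (polyHO n).eval (x : ℂ) * gaussHO x) x = _ := h
    rw [Aplus, h']
    simp only [polyHO, Polynomial.eval_mul, Polynomial.eval_sub, Polynomial.eval_C,
      Polynomial.eval_X]
    ring

lemma polyHO_coeff (n : ℕ) :
    (polyHO n).natDegree ≤ n ∧ (polyHO n).coeff n = (2 * Complex.I) ^ n := by
  induction n with
  | zero => simp [polyHO]
  | succ n ih =>
    obtain ⟨h1, h2⟩ := ih
    constructor
    · rw [polyHO]
      refine (Polynomial.natDegree_C_mul_le _ _).trans ?_
      refine (Polynomial.natDegree_sub_le _ _).trans (max_le ?_ ?_)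
      · refine (Polynomial.natDegree_C_mul_le _ _).trans ?_
        refine Polynomial.natDegree_mul_le.trans ?_
        have := Polynomial.natDegree_X_le (R := ℂ)
        omega
      · have := Polynomial.natDegree_derivative_le (polyHO n)
        omega
    · have h3 : (polyHO n).coeff (n + 1 + 1) = 0 :=
        Polynomial.coeff_eq_zero_of_natDegree_lt (by omega)
      rw [polyHO, Polynomial.coeff_C_mul, Polynomial.coeff_sub, Polynomial.coeff_C_mul,
        Polynomial.coeff_X_mul, Polynomial.coeff_derivative, h3, h2]
      ring

lemma polyHO_degree (n : ℕ) : (polyHO n).degree = n := by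
  obtain ⟨h1, h2⟩ := polyHO_coeff n
  refine Polynomial.degree_eq_of_le_of_coeff_ne_zero
    (Polynomial.natDegree_le_iff_degree_le.mp h1) ?_
  rw [h2]
  exact pow_ne_zero _ (by simp)

/-- The polynomials as a sequence. -/
noncomputable def seqHO : Polynomial.Sequence ℂ := ⟨polyHO, polyHO_degree⟩

lemma span_polyHO : Submodule.span ℂ (Set.range polyHO) = ⊤ :=
  seqHO.span (fun i => by
    rw [isUnit_iff_ne_zero]
    exact Polynomial.leadingCoeff_ne_zero.mpr (seqHO.ne_zero i))

/-! Integrability -/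

lemma memLp_quarter : MemLp (fun x : ℝ => Real.exp (-x ^ 2 / 4)) 2 volume := by
  rw [memLp_two_iff_integrable_sq (by fun_prop)]
  have := integrable_exp_neg_mul_sq (b := 1 / 2) (by norm_num)
  refine this.congr (Filter.Eventually.of_forall fun x => ?_)
  simp only [← Real.exp_nat_mul]
  congr 1
  push_cast
  ring

lemma memLp_expabs (c : ℝ) :
    MemLp (fun x : ℝ => Real.exp (|c * x|) * Real.exp (-x ^ 2 / 2)) 2 volume := by
  refine (memLp_quarter.const_mul (Real.exp (c ^ 2))).mono (by fun_prop)
    (Filter.Eventually.of_forall fun x => ?_)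
  rw [Real.norm_of_nonneg (by positivity), Real.norm_of_nonneg (by positivity),
    ← Real.exp_add, ← Real.exp_add]
  apply Real.exp_le_exp.mpr
  rw [abs_mul]
  nlinarith [sq_nonneg (|c| - |x| / 2), sq_abs c, sq_abs x]

lemma memLp_poly (p : Polynomial ℂ) :
    MemLp (fun x : ℝ => p.eval (x : ℂ) * gaussHO x) 2 volume := by
  induction p using Polynomial.induction_on' with
  | add p q hp hq =>
    refine (hp.add hq).ae_eq (Filter.Eventually.of_forall fun x => ?_)
    simp [add_mul]
  | monomial n a =>
    refine ((memLp_expabs 1).const_mul (‖a‖ * n.factorial)).mono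
      ((poly_continuous _).mul gaussHO_continuous).aestronglyMeasurable
      (Filter.Eventually.of_forall fun x => ?_)
    have h := Real.pow_div_factorial_le_exp (x := |x|) (abs_nonneg x) n
    rw [div_le_iff₀ (by positivity)] at h
    rw [Real.norm_of_nonneg (by positivity), norm_mul, norm_gaussHO, Polynomial.eval_monomial,
      norm_mul, norm_pow, Complex.norm_real, Real.norm_eq_abs, one_mul]
    calc ‖a‖ * |x| ^ n * Real.exp (-x ^ 2 / 2)
        ≤ ‖a‖ * (Real.exp |x| * n.factorial) * Real.exp (-x ^ 2 / 2) := by gcongr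
      _ = _ := by ring

lemma integrable_poly_mul {g : ℝ → ℂ} (hg : MemLp g 2 volume) (p : Polynomial ℂ) :
    Integrable (fun x : ℝ => p.eval (x : ℂ) * gaussHO x * g x) :=
  (memLp_poly p).integrable_mul hg

lemma memLp_gaussHO : MemLp gaussHO 2 volume := by
  have := memLp_poly 1
  simpa using this

lemma integral_parts (p : Polynomial ℂ) :
    ∫ x : ℝ, (p.derivative - Polynomial.C 2 * (Polynomial.X * p)).eval (x : ℂ)
      * gaussHO x * gaussHO x = 0 := by
  refine integral_eq_zero_of_hasDerivAt_of_integrable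
    (f := fun x : ℝ => p.eval (x : ℂ) * gaussHO x * gaussHO x) (fun x => ?_)
    (integrable_poly_mul memLp_gaussHO _) (integrable_poly_mul memLp_gaussHO _)
  have := ((poly_hasDerivAt p x).mul (gaussHO_hasDerivAt x)).mul (gaussHO_hasDerivAt x)
  refine this.congr_deriv ?_
  simp only [Polynomial.eval_mul, Polynomial.eval_sub, Polynomial.eval_C, Polynomial.eval_X,
    Pi.mul_apply]
  ring

lemma integral_lower (n : ℕ) : ∀ q : Polynomial ℂ, q.degree < n →
    ∫ x : ℝ, (q * polyHO n).eval (x : ℂ) * gaussHO x * gaussHO x = 0 := by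
  induction n with
  | zero =>
    intro q hq
    have : q = 0 := by
      by_contra h
      rw [Polynomial.degree_eq_natDegree h] at hq
      exact absurd (Nat.cast_lt.mp hq) (by omega)
    simp [this]
  | succ n ih =>
    intro q hq
    have hq' : q.derivative.degree < n := by
      by_cases h0 : q = 0
      · simp [h0]
      by_cases h1 : q.natDegree = 0
      · rw [Polynomial.derivative_of_natDegree_zero h1]; simp
      · have h2 : q.natDegree < n + 1 := by
          rw [Polynomial.degree_eq_natDegree h0] at hq
          exact_mod_cast hq
        refine lt_of_le_of_lt Polynomial.degree_le_natDegree ?_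
        have := Polynomial.natDegree_derivative_lt h1
        exact_mod_cast (by omega : q.derivative.natDegree < n)
    have e : q * polyHO (n + 1) = Polynomial.C Complex.I * (q.derivative * polyHO n)
        - Polynomial.C Complex.I * (Polynomial.derivative (q * polyHO n)
          - Polynomial.C 2 * (Polynomial.X * (q * polyHO n))) := by
      rw [polyHO, Polynomial.derivative_mul]; ring
    have e2 : ∀ x : ℝ, (q * polyHO (n + 1)).eval (x : ℂ) * gaussHO x * gaussHO x =
        Complex.I * ((q.derivative * polyHO n).eval (x : ℂ) * gaussHO x * gaussHO x) -
        Complex.I * ((Polynomial.derivative (q * polyHO n)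
          - Polynomial.C 2 * (Polynomial.X * (q * polyHO n))).eval (x : ℂ)
          * gaussHO x * gaussHO x) := by
      intro x
      rw [e, Polynomial.eval_sub, Polynomial.eval_mul, Polynomial.eval_mul (p := Polynomial.C _),
        Polynomial.eval_C]
      ring
    simp_rw [e2]
    rw [integral_sub ((integrable_poly_mul memLp_gaussHO _).const_mul _)
      ((integrable_poly_mul memLp_gaussHO _).const_mul _), integral_const_mul,
      integral_const_mul, ih _ hq', integral_parts]
    simp

lemma conj_poly (p : Polynomial ℂ) (x : ℝ) :
    (starRingEnd ℂ) (p.eval (x : ℂ)) = (p.map (starRingEnd ℂ)).eval (x : ℂ) := by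
  have := Polynomial.eval_map_apply (p := p) (f := starRingEnd ℂ) (x : ℂ)
  rw [Complex.conj_ofReal] at this
  exact this.symm

lemma orth_lt (m n : ℕ) (h : m < n) :
    ∫ x : ℝ, (starRingEnd ℂ) (uHO m x) * uHO n x = 0 := by
  have hd : ((polyHO m).map (starRingEnd ℂ)).degree < n := by
    refine lt_of_le_of_lt Polynomial.degree_map_le ?_
    rw [polyHO_degree]
    exact_mod_cast h
  rw [← integral_lower n _ hd]
  congr 1
  funext x
  rw [uHO_eq, uHO_eq]
  simp only [map_mul, conj_gaussHO, conj_poly, Polynomial.eval_mul]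
  ring

lemma orth (m n : ℕ) (h : m ≠ n) :
    ∫ x : ℝ, (starRingEnd ℂ) (uHO m x) * uHO n x = 0 := by
  rcases lt_or_gt_of_ne h with h | h
  · exact orth_lt m n h
  · have := congrArg (starRingEnd ℂ) (orth_lt n m h)
    rw [← integral_conj] at this
    simp only [map_mul, Complex.conj_conj, map_zero] at this
    rw [← this]
    congr 1
    funext x
    ring

lemma uHO_ne (n : ℕ) : ∃ x : ℝ, uHO n x ≠ 0 := by
  by_contra! h
  have h0 : polyHO n ≠ 0 := seqHO.ne_zero n
  refine h0 (Polynomial.eq_zero_of_infinite_isRoot _ ?_)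
  refine (Set.infinite_range_of_injective Complex.ofReal_injective).mono ?_
  rintro _ ⟨x, rfl⟩
  have := h x
  rw [uHO_eq] at this
  exact (mul_eq_zero.mp this).resolve_right (gaussHO_ne_zero x)

/-! Completeness -/

lemma moments {g : ℝ → ℂ} (hg : MemLp g 2 volume)
    (h : ∀ n, ∫ x : ℝ, (polyHO n).eval (x : ℂ) * gaussHO x * g x = 0) (p : Polynomial ℂ) :
    ∫ x : ℝ, p.eval (x : ℂ) * gaussHO x * g x = 0 := by
  have hp : p ∈ Submodule.span ℂ (Set.range polyHO) := by rw [span_polyHO]; trivial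
  induction hp using Submodule.span_induction with
  | mem x hx => obtain ⟨n, rfl⟩ := hx; exact h n
  | zero => simp
  | add p q _ _ hp hq =>
    simp only [Polynomial.eval_add, add_mul]
    rw [integral_add (integrable_poly_mul hg p) (integrable_poly_mul hg q), hp, hq, add_zero]
  | smul a p _ hp =>
    simp only [Polynomial.eval_smul, smul_eq_mul, mul_assoc] at hp ⊢
    rw [integral_const_mul, hp, mul_zero]

lemma fourierHO_vanish {g : ℝ → ℂ} (hg : MemLp g 2 volume)
    (h : ∀ p : Polynomial ℂ, ∫ x : ℝ, p.eval (x : ℂ) * gaussHO x * g x = 0) (w : ℝ) :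
    ∫ x : ℝ, Complex.exp (((w * x : ℝ) : ℂ) * Complex.I) * (gaussHO x * g x) = 0 := by
  have key := hasSum_integral_of_dominated_convergence (μ := (volume : Measure ℝ))
    (F := fun (n : ℕ) (x : ℝ) =>
      (((w * x : ℝ) : ℂ) * Complex.I) ^ n / (n.factorial : ℂ) * (gaussHO x * g x))
    (f := fun x : ℝ => Complex.exp (((w * x : ℝ) : ℂ) * Complex.I) * (gaussHO x * g x))
    (fun n x => |w * x| ^ n / (n.factorial : ℝ) * (Real.exp (-x ^ 2 / 2) * ‖g x‖))
    (fun n => ?_) (fun n => ?_) ?_ ?_ ?_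
  · refine key.unique ?_
    convert hasSum_zero with n
    have := h (Polynomial.C (((w : ℂ) * Complex.I) ^ n / (n.factorial : ℂ)) * Polynomial.X ^ n)
    rw [← this]
    congr 1
    funext x
    simp only [Polynomial.eval_mul, Polynomial.eval_C, Polynomial.eval_pow, Polynomial.eval_X]
    push_cast
    ring
  · exact (Continuous.aestronglyMeasurable (by fun_prop)).mul
      (gaussHO_continuous.aestronglyMeasurable.mul hg.1)
  · refine Filter.Eventually.of_forall fun x => le_of_eq ?_
    simp [norm_gaussHO, abs_mul]
  · exact Filter.Eventually.of_forall fun x =>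
      (Real.summable_pow_div_factorial _).mul_right _
  · have h1 := (memLp_expabs w).integrable_mul hg.norm
    refine h1.congr (Filter.Eventually.of_forall fun x => ?_)
    simp only [Pi.mul_apply]
    rw [tsum_mul_right, Real.exp_eq_exp_ℝ, NormedSpace.exp_eq_tsum_div]
    ring
  · refine Filter.Eventually.of_forall fun x => ?_
    refine HasSum.mul_right _ ?_
    rw [Complex.exp_eq_exp_ℂ]
    exact NormedSpace.expSeries_div_hasSum_exp _

open scoped FourierTransform ContDiff in
lemma ae_zero_of_fourier {G : ℝ → ℂ} (hG : Integrable G)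
    (h : ∀ w : ℝ, ∫ x : ℝ, Complex.exp (((w * x : ℝ) : ℂ) * Complex.I) * G x = 0) :
    ∀ᵐ x, G x = 0 := by
  have hF : ∀ w : ℝ, 𝓕 G w = 0 := by
    intro w
    rw [Real.fourier_real_eq_integral_exp_smul, ← h (-2 * Real.pi * w)]
    congr 1
    funext x
    rw [smul_eq_mul]
    congr 4
    ring
  refine ae_eq_zero_of_integral_contDiff_smul_eq_zero hG.locallyIntegrable ?_
  intro φ hφ hc
  have hc' : HasCompactSupport (fun x => (φ x : ℂ)) := hc.comp_left Complex.ofReal_zero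
  have hφ' : ContDiff ℝ ∞ (fun x => (φ x : ℂ)) := Complex.ofRealCLM.contDiff.comp hφ
  let ψ : SchwartzMap ℝ ℂ := hc'.toSchwartzMap hφ'
  let χ : SchwartzMap ℝ ℂ := 𝓕⁻ ψ
  have hχ : 𝓕 (χ : ℝ → ℂ) = fun x => (φ x : ℂ) := by
    rw [← SchwartzMap.fourier_coe]
    have : 𝓕 χ = ψ := FourierTransform.fourier_fourierInv_eq ψ
    rw [this]
    rfl
  have key := VectorFourier.integral_fourierIntegral_smul_eq_flip (μ := volume) (ν := volume)
    (e := Real.fourierChar) (L := innerₗ ℝ) Real.continuous_fourierChar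
    continuous_inner χ.integrable hG
  have e1 : VectorFourier.fourierIntegral Real.fourierChar volume (innerₗ ℝ) (χ : ℝ → ℂ)
    = fun x => (φ x : ℂ) := hχ
  have e2 : VectorFourier.fourierIntegral Real.fourierChar volume (innerₗ ℝ).flip G = 0 := by
    rw [flip_innerₗ]
    funext w
    exact hF w
  rw [e1, e2] at key
  simpa using key

lemma dense_HO : Dense ((Submodule.span ℂ
        {g : Lp ℂ 2 (volume : Measure ℝ) | ∃ n : ℕ, (g : ℝ → ℂ) =ᵐ[volume] uHO n} :
          Submodule ℂ (Lp ℂ 2 (volume : Measure ℝ))) :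
        Set (Lp ℂ 2 (volume : Measure ℝ))) := by
  rw [Submodule.dense_iff_topologicalClosure_eq_top, Submodule.topologicalClosure_eq_top_iff,
    Submodule.eq_bot_iff]
  intro f hf
  rw [Submodule.mem_orthogonal'] at hf
  have hg : MemLp (fun x => (starRingEnd ℂ) (f x)) 2 volume := (Lp.memLp f).star
  have h0 : ∀ n, ∫ x : ℝ, (polyHO n).eval (x : ℂ) * gaussHO x * (starRingEnd ℂ) (f x) = 0 := by
    intro n
    have hu : MemLp (uHO n) 2 volume := by rw [uHO_eq]; exact memLp_poly _
    have := hf (hu.toLp _) (Submodule.subset_span ⟨n, hu.coeFn_toLp⟩)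
    rw [L2.inner_def] at this
    rw [← this]
    refine integral_congr_ae ?_
    filter_upwards [hu.coeFn_toLp] with x hx
    rw [hx, uHO_eq]
    simp [RCLike.inner_apply]
  have h1 := ae_zero_of_fourier (memLp_gaussHO.integrable_mul hg)
    (fun w => fourierHO_vanish hg (moments hg h0) w)
  rw [Lp.eq_zero_iff_ae_eq_zero]
  filter_upwards [h1] with x hx
  have := (mul_eq_zero.mp hx).resolve_left (gaussHO_ne_zero x)
  simpa using this

/-- the `u_n` are pairwise orthogonal in `L²(ℝ; ℂ)`, each is nonzero,
and the closed linear span of the corresponding `L²` classes is all of `L²(ℝ; ℂ)`. -/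
theorem harmonic_oscillator_complete_orthogonal :
    (∀ m n : ℕ, m ≠ n → ∫ x : ℝ, (starRingEnd ℂ) (uHO m x) * uHO n x = 0) ∧
    (∀ n : ℕ, ∃ x : ℝ, uHO n x ≠ 0) ∧
    Dense ((Submodule.span ℂ
        {g : Lp ℂ 2 (volume : Measure ℝ) | ∃ n : ℕ, (g : ℝ → ℂ) =ᵐ[volume] uHO n} :
          Submodule ℂ (Lp ℂ 2 (volume : Measure ℝ))) :
        Set (Lp ℂ 2 (volume : Measure ℝ))) := by
  exact ⟨orth, uHO_ne, dense_HO⟩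
end

section
/- Let d ≥ 1 and let k be an integer with k > d/2. Then there is a constant C such that for all h ∈ (0,1] and all Schwartz functions f₁, f₂ on ℝ^d, ‖f₁ f₂‖_{H^k_h} ≤ C h^{−d/2} ‖f₁‖_{H^k_h} ‖f₂‖_{H^k_h}, where the semiclassical Sobolev norm is ‖f‖_{H^k_h} = ‖ (1 + h²|ξ|²)^{k/2} 𝔉f ‖_{L²(ℝ^d)}. -/
open MeasureTheory
open scoped RealInnerProductSpace

/-- The Fourier transform on `ℝ^d` normalized by
`𝔉f(ξ) = (2π)^{−d/2} ∫ e^{−i⟨x,ξ⟩} f(x) dx`. -/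
noncomputable def fourierTr (d : ℕ) (f : EuclideanSpace ℝ (Fin d) → ℂ)
    (ξ : EuclideanSpace ℝ (Fin d)) : ℂ :=
  (((2 * Real.pi) ^ (-(d : ℝ) / 2) : ℝ) : ℂ) *
    ∫ x : EuclideanSpace ℝ (Fin d), Complex.exp (-Complex.I * ((⟪x, ξ⟫ : ℝ) : ℂ)) * f x

/-- The semiclassical Sobolev norm `‖f‖_{H^k_h} = ‖(1 + h²|ξ|²)^{k/2} 𝔉f‖_{L²(ℝ^d)}`. -/
noncomputable def HkhNorm (d : ℕ) (h : ℝ) (k : ℕ) (f : EuclideanSpace ℝ (Fin d) → ℂ) : ℝ :=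
  Real.sqrt (∫ ξ : EuclideanSpace ℝ (Fin d),
    ‖(((1 + h ^ 2 * ‖ξ‖ ^ 2) ^ ((k : ℝ) / 2) : ℝ) : ℂ) * fourierTr d f ξ‖ ^ 2)

open scoped ENNReal FourierTransform

/-- Weighted Cauchy–Schwarz estimate for a convolution. -/
lemma weighted_conv_aux (d : ℕ) (k : ℕ) (a : ℝ) 
    (W A B : EuclideanSpace ℝ (Fin d) → ℝ≥0∞)
    (hW : ∀ ξ, W ξ = ENNReal.ofReal ((1 + a ^ 2 * ‖ξ‖ ^ 2) ^ k))
    (hA : Measurable A) (hB : Measurable B) :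
    ∫⁻ ξ, W ξ * (∫⁻ η, A η * B (ξ - η)) ^ 2 ≤
      (4 ^ k * (2 * ∫⁻ ξ, (W ξ)⁻¹)) *
        ((∫⁻ ξ, W ξ * A ξ ^ 2) * (∫⁻ ξ, W ξ * B ξ ^ 2)) := by
  have hWm : Measurable W := by
    have : W = fun ξ => ENNReal.ofReal ((1 + a ^ 2 * ‖ξ‖ ^ 2) ^ k) := funext hW
    rw [this]; fun_prop
  have hW0 : ∀ ξ, W ξ ≠ 0 := by
    intro ξ; rw [hW]; simp only [ne_eq, ENNReal.ofReal_eq_zero, not_le]; positivity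
  have hWt : ∀ ξ, W ξ ≠ ∞ := by intro ξ; rw [hW]; exact ENNReal.ofReal_ne_top
  -- Peetre type inequality
  have peetre : ∀ ξ η, W ξ ≤ 4 ^ k * (W η + W (ξ - η)) := by
    intro ξ η
    rw [hW, hW, hW, ← ENNReal.ofReal_add (by positivity) (by positivity)]
    have h4 : (4 : ℝ≥0∞) ^ k = ENNReal.ofReal (4 ^ k) := by
      rw [ENNReal.ofReal_pow (by norm_num)]; norm_num
    rw [h4, ← ENNReal.ofReal_mul (by positivity)]
    apply ENNReal.ofReal_le_ofReal
    have htri : ‖ξ‖ ≤ ‖η‖ + ‖ξ - η‖ := by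
      have := norm_add_le η (ξ - η); simpa using this
    set p := 1 + a ^ 2 * ‖η‖ ^ 2 with hp
    set q := 1 + a ^ 2 * ‖ξ - η‖ ^ 2 with hq
    have hp0 : 0 ≤ p := by positivity
    have hq0 : 0 ≤ q := by positivity
    have hsq : ‖ξ‖ ^ 2 ≤ 2 * ‖η‖ ^ 2 + 2 * ‖ξ - η‖ ^ 2 := by
      have h1 : ‖ξ‖ ^ 2 ≤ (‖η‖ + ‖ξ - η‖) ^ 2 := by gcongr
      nlinarith [sq_nonneg (‖η‖ - ‖ξ - η‖)]
    have h2 : 1 + a ^ 2 * ‖ξ‖ ^ 2 ≤ 2 * (p + q) := by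
      have := mul_le_mul_of_nonneg_left hsq (sq_nonneg a)
      rw [hp, hq]; nlinarith
    have h3 : 1 + a ^ 2 * ‖ξ‖ ^ 2 ≤ 4 * max p q := by
      have := le_max_left p q
      have := le_max_right p q
      linarith
    calc (1 + a ^ 2 * ‖ξ‖ ^ 2) ^ k ≤ (4 * max p q) ^ k := by gcongr
      _ = 4 ^ k * (max p q) ^ k := mul_pow _ _ _
      _ ≤ 4 ^ k * (p ^ k + q ^ k) := by
        gcongr
        rcases max_cases p q with h | h <;> rw [h.1]
        · have : 0 ≤ q ^ k := by positivity
          linarith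
        · have : 0 ≤ p ^ k := by positivity
          linarith
  have ratio : ∀ ξ η, W ξ * ((W η)⁻¹ * (W (ξ - η))⁻¹) ≤
      4 ^ k * ((W η)⁻¹ + (W (ξ - η))⁻¹) := by
    intro ξ η
    calc W ξ * ((W η)⁻¹ * (W (ξ - η))⁻¹)
        ≤ 4 ^ k * (W η + W (ξ - η)) * ((W η)⁻¹ * (W (ξ - η))⁻¹) := by
          gcongr; exact peetre ξ η
      _ = 4 ^ k * ((W η * (W η)⁻¹) * (W (ξ - η))⁻¹ +
            (W (ξ - η) * (W (ξ - η))⁻¹) * (W η)⁻¹) := by ring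
      _ = _ := by
        rw [ENNReal.mul_inv_cancel (hW0 _) (hWt _), ENNReal.mul_inv_cancel (hW0 _) (hWt _)]
        ring
  have pointwise : ∀ ξ, W ξ * (∫⁻ η, A η * B (ξ - η)) ^ 2 ≤
      (4 ^ k * (2 * ∫⁻ ξ, (W ξ)⁻¹)) *
        ∫⁻ η, (W η * A η ^ 2) * (W (ξ - η) * B (ξ - η) ^ 2) := by
    intro ξ
    have CS := ENNReal.lintegral_mul_le_Lp_mul_Lq (volume : Measure (EuclideanSpace ℝ (Fin d)))
      Real.HolderConjugate.two_two
      (f := fun η => ((W η)⁻¹ * (W (ξ - η))⁻¹) ^ (1 / 2 : ℝ))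
      (g := fun η => ((W η * A η ^ 2) * (W (ξ - η) * B (ξ - η) ^ 2)) ^ (1 / 2 : ℝ))
      (by fun_prop) (by fun_prop)
    have hpt : ∀ η, ((fun η => ((W η)⁻¹ * (W (ξ - η))⁻¹) ^ (1 / 2 : ℝ)) *
      (fun η => ((W η * A η ^ 2) * (W (ξ - η) * B (ξ - η) ^ 2)) ^ (1 / 2 : ℝ))) η
        = A η * B (ξ - η) := by
      intro η
      simp only [Pi.mul_apply]
      rw [← ENNReal.mul_rpow_of_nonneg _ _ (by norm_num)]
      have : (W η)⁻¹ * (W (ξ - η))⁻¹ * (W η * A η ^ 2 * (W (ξ - η) * B (ξ - η) ^ 2))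
          = (A η * B (ξ - η)) ^ 2 := by
        calc _ = (W η * (W η)⁻¹) * (W (ξ - η) * (W (ξ - η))⁻¹) * (A η * B (ξ - η)) ^ 2 := by ring
          _ = _ := by
            rw [ENNReal.mul_inv_cancel (hW0 _) (hWt _), ENNReal.mul_inv_cancel (hW0 _) (hWt _)]
            ring
      rw [this, ← ENNReal.rpow_natCast, ← ENNReal.rpow_mul]
      norm_num
    have hhalf : ∀ x : ℝ≥0∞, (x ^ (1 / 2 : ℝ)) ^ (2 : ℝ) = x := by
      intro x; rw [← ENNReal.rpow_mul]; norm_num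
    have hhalf' : ∀ x : ℝ≥0∞, (x ^ (1 / 2 : ℝ)) ^ 2 = x := by
      intro x; rw [← ENNReal.rpow_natCast, ← ENNReal.rpow_mul]; norm_num
    rw [lintegral_congr hpt] at CS
    simp only [hhalf] at CS
    have CS2 : (∫⁻ η, A η * B (ξ - η)) ^ 2 ≤ (∫⁻ η, (W η)⁻¹ * (W (ξ - η))⁻¹) *
        ∫⁻ η, (W η * A η ^ 2) * (W (ξ - η) * B (ξ - η) ^ 2) := by
      calc _ ≤ _ := pow_le_pow_left' CS 2
        _ = _ := by rw [mul_pow, hhalf', hhalf']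
    calc W ξ * (∫⁻ η, A η * B (ξ - η)) ^ 2
        ≤ W ξ * ((∫⁻ η, (W η)⁻¹ * (W (ξ - η))⁻¹) *
          ∫⁻ η, (W η * A η ^ 2) * (W (ξ - η) * B (ξ - η) ^ 2)) := by gcongr
      _ = (∫⁻ η, W ξ * ((W η)⁻¹ * (W (ξ - η))⁻¹)) *
          ∫⁻ η, (W η * A η ^ 2) * (W (ξ - η) * B (ξ - η) ^ 2) := by
        rw [lintegral_const_mul _ (by fun_prop), mul_assoc]
      _ ≤ (∫⁻ η, 4 ^ k * ((W η)⁻¹ + (W (ξ - η))⁻¹)) *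
          ∫⁻ η, (W η * A η ^ 2) * (W (ξ - η) * B (ξ - η) ^ 2) := by
        exact mul_le_mul_left (lintegral_mono (ratio ξ)) _
      _ = _ := by
        rw [lintegral_const_mul _ (by fun_prop), lintegral_add_left (by fun_prop),
          lintegral_sub_left_eq_self (fun η => (W η)⁻¹) ξ, two_mul]
  calc ∫⁻ ξ, W ξ * (∫⁻ η, A η * B (ξ - η)) ^ 2
      ≤ ∫⁻ ξ, (4 ^ k * (2 * ∫⁻ ξ, (W ξ)⁻¹)) *
        ∫⁻ η, (W η * A η ^ 2) * (W (ξ - η) * B (ξ - η) ^ 2) := lintegral_mono pointwise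
    _ = (4 ^ k * (2 * ∫⁻ ξ, (W ξ)⁻¹)) *
        ∫⁻ ξ, ∫⁻ η, (W η * A η ^ 2) * (W (ξ - η) * B (ξ - η) ^ 2) := by
      rw [lintegral_const_mul]
      exact Measurable.lintegral_prod_right' (f := fun p : _ × _ =>
        (W p.2 * A p.2 ^ 2) * (W (p.1 - p.2) * B (p.1 - p.2) ^ 2)) (by fun_prop)
    _ = _ := by
      congr 1
      rw [lintegral_lintegral_swap (by fun_prop)]
      have : ∀ η, ∫⁻ ξ, (W η * A η ^ 2) * (W (ξ - η) * B (ξ - η) ^ 2)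
          = (W η * A η ^ 2) * ∫⁻ ξ, W ξ * B ξ ^ 2 := by
        intro η
        rw [lintegral_const_mul _ (by fun_prop),
          lintegral_sub_right_eq_self (fun ξ => W ξ * B ξ ^ 2) η]
      rw [lintegral_congr this, lintegral_mul_const _ (by fun_prop)]

/-- Relation with Mathlib's inverse Fourier transform. -/
lemma fourierTr_eq_aux (d : ℕ) (f : EuclideanSpace ℝ (Fin d) → ℂ)
    (ξ : EuclideanSpace ℝ (Fin d)) :
    fourierTr d f ξ = (((2 * Real.pi) ^ (-(d : ℝ) / 2) : ℝ) : ℂ) *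
      𝓕⁻ f ((-(2 * Real.pi)⁻¹ : ℝ) • ξ) := by
  unfold fourierTr
  congr 1
  rw [Real.fourierInv_eq']
  congr 1
  ext x
  rw [smul_eq_mul, inner_smul_right]
  congr 2
  push_cast
  have : (Real.pi : ℂ) ≠ 0 := by exact_mod_cast Real.pi_ne_zero
  field_simp

lemma HkhNorm_eq_aux (d : ℕ) (h : ℝ) (k : ℕ) (f : EuclideanSpace ℝ (Fin d) → ℂ) :
    HkhNorm d h k f = Real.sqrt (∫ ξ : EuclideanSpace ℝ (Fin d),
      (1 + (2 * Real.pi * h) ^ 2 * ‖ξ‖ ^ 2) ^ k * ‖𝓕⁻ f ξ‖ ^ 2) := by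
  unfold HkhNorm
  congr 1
  have hpi := Real.pi_pos
  have key := Measure.integral_comp_smul (volume : Measure (EuclideanSpace ℝ (Fin d)))
    (fun ξ => (1 + (2 * Real.pi * h) ^ 2 * ‖ξ‖ ^ 2) ^ k * ‖𝓕⁻ f ξ‖ ^ 2) (-(2 * Real.pi)⁻¹)
  have hc : |((-(2 * Real.pi)⁻¹) ^ Module.finrank ℝ (EuclideanSpace ℝ (Fin d)))⁻¹|
      = (2 * Real.pi) ^ d := by
    rw [finrank_euclideanSpace_fin, abs_inv, abs_pow, abs_neg, abs_of_pos (by positivity),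
      inv_pow, inv_inv]
  rw [hc, smul_eq_mul] at key
  have hc2 : ((2 * Real.pi) ^ (-(d : ℝ) / 2)) ^ 2 * (2 * Real.pi) ^ d = 1 := by
    rw [← Real.rpow_natCast, ← Real.rpow_natCast, ← Real.rpow_mul (by positivity),
      ← Real.rpow_add (by positivity)]
    have : -(d : ℝ) / 2 * ((2 : ℕ) : ℝ) + d = 0 := by push_cast; ring
    rw [this, Real.rpow_zero]
  calc _ = ∫ ξ : EuclideanSpace ℝ (Fin d), ((2 * Real.pi) ^ (-(d : ℝ) / 2)) ^ 2 *
        ((1 + (2 * Real.pi * h) ^ 2 * ‖(-(2 * Real.pi)⁻¹ : ℝ) • ξ‖ ^ 2) ^ k *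
          ‖𝓕⁻ f ((-(2 * Real.pi)⁻¹ : ℝ) • ξ)‖ ^ 2) := by
        congr 1
        ext ξ
        rw [fourierTr_eq_aux, norm_mul, norm_mul, Complex.norm_real, Complex.norm_real,
          Real.norm_of_nonneg (by positivity), Real.norm_of_nonneg (by positivity),
          mul_pow, mul_pow, norm_smul, ← Real.rpow_natCast _ 2, ← Real.rpow_mul (by positivity)]
        have e1 : (k : ℝ) / 2 * ((2 : ℕ) : ℝ) = k := by push_cast; ring
        have e2 : (2 * Real.pi * h) ^ 2 * (‖(-(2 * Real.pi)⁻¹ : ℝ)‖ * ‖ξ‖) ^ 2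
            = h ^ 2 * ‖ξ‖ ^ 2 := by
          rw [norm_neg, Real.norm_of_nonneg (by positivity)]
          field_simp
        rw [e1, Real.rpow_natCast, e2]
        ring
    _ = _ := by
      rw [integral_const_mul, key, ← mul_assoc, hc2, one_mul]

lemma conv_bound_aux (d : ℕ) (f g : SchwartzMap (EuclideanSpace ℝ (Fin d)) ℂ)
    (ξ : EuclideanSpace ℝ (Fin d)) :
    ‖𝓕⁻ (fun x => f x * g x) ξ‖ₑ ≤ ∫⁻ η, ‖(𝓕⁻ f) η‖ₑ * ‖(𝓕⁻ g) (ξ - η)‖ₑ := by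
  have h1 := SchwartzMap.convolution_apply (ContinuousLinearMap.mul ℂ ℂ) (𝓕⁻ f) (𝓕⁻ g) ξ
  have h2 : SchwartzMap.convolution (ContinuousLinearMap.mul ℂ ℂ) (𝓕⁻ f) (𝓕⁻ g)
      = 𝓕⁻ (SchwartzMap.pairing (ContinuousLinearMap.mul ℂ ℂ) f g) := by
    simp [SchwartzMap.convolution]
  have h3 : 𝓕⁻ (fun x => f x * g x) ξ =
      (𝓕⁻ (SchwartzMap.pairing (ContinuousLinearMap.mul ℂ ℂ) f g)) ξ := by
    rw [SchwartzMap.fourierInv_coe]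
    congr 1
  rw [h3, ← h2, h1, convolution_def]
  refine (enorm_integral_le_lintegral_enorm _).trans (le_of_eq ?_)
  congr 1
  ext η
  simp [enorm_mul]

lemma integrable_aux (d k : ℕ) (a : ℝ) (f : SchwartzMap (EuclideanSpace ℝ (Fin d)) ℂ) :
    Integrable (fun ξ => (1 + a ^ 2 * ‖ξ‖ ^ 2) ^ k * ‖f ξ‖ ^ 2) := by
  have hg : (fun ξ : EuclideanSpace ℝ (Fin d) =>
      (1 + a ^ 2 * ‖ξ‖ ^ 2) ^ k).HasTemperateGrowth := by fun_prop
  have := (SchwartzMap.pairing (ContinuousLinearMap.mul ℂ ℂ)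
    (SchwartzMap.smulLeftCLM ℂ (fun ξ : EuclideanSpace ℝ (Fin d) =>
      (1 + a ^ 2 * ‖ξ‖ ^ 2) ^ k) f) f).integrable (μ := volume) |>.norm
  refine this.congr (Filter.Eventually.of_forall fun ξ => ?_)
  simp only [SchwartzMap.pairing_apply_apply, SchwartzMap.smulLeftCLM_apply_apply hg,
    ContinuousLinearMap.mul_apply', norm_mul, norm_smul]
  rw [Real.norm_of_nonneg (by positivity)]
  ring

lemma weight_integral_aux (d k : ℕ) (hk : (d : ℝ) / 2 < k) (a : ℝ) (ha : 0 < a) :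
    ∫⁻ ξ : EuclideanSpace ℝ (Fin d), (ENNReal.ofReal ((1 + a ^ 2 * ‖ξ‖ ^ 2) ^ k))⁻¹ =
    ENNReal.ofReal ((a ^ d)⁻¹ *
      ∫ ξ : EuclideanSpace ℝ (Fin d), ((1 + ‖ξ‖ ^ 2) ^ k)⁻¹) := by
  have hint : Integrable (fun ξ : EuclideanSpace ℝ (Fin d) => ((1 + ‖ξ‖ ^ 2) ^ k)⁻¹) := by
    have := integrable_rpow_neg_one_add_norm_sq (E := EuclideanSpace ℝ (Fin d))
      (μ := volume) (r := 2 * k) (by rw [finrank_euclideanSpace_fin]; linarith)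
    refine this.congr (Filter.Eventually.of_forall fun ξ => ?_)
    have e : -(2 * (k : ℝ)) / 2 = -(k : ℝ) := by ring
    simp only [e]
    rw [Real.rpow_neg (by positivity), Real.rpow_natCast]
  have hint2 := hint.comp_smul (R := a) ha.ne'
  have key := Measure.integral_comp_smul (volume : Measure (EuclideanSpace ℝ (Fin d)))
    (fun ξ => ((1 + ‖ξ‖ ^ 2) ^ k)⁻¹) a
  rw [finrank_euclideanSpace_fin, smul_eq_mul, abs_of_pos (by positivity)] at key
  rw [← key, ofReal_integral_eq_lintegral_ofReal hint2
    (Filter.Eventually.of_forall fun ξ => by positivity)]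
  congr 1
  ext ξ
  rw [norm_smul, mul_pow, Real.norm_of_nonneg ha.le, ENNReal.ofReal_inv_of_pos (by positivity)]

/-- the semiclassical algebra estimate
`‖f₁ f₂‖_{H^k_h} ≤ C h^{−d/2} ‖f₁‖_{H^k_h} ‖f₂‖_{H^k_h}` for `k > d/2`, uniformly in
`h ∈ (0,1]` and Schwartz functions `f₁, f₂`. -/
theorem semiclassical_sobolev_algebra (d : ℕ) (hd : 1 ≤ d) (k : ℕ)
    (hk : (d : ℝ) / 2 < k) :
    ∃ C : ℝ, ∀ h : ℝ, 0 < h → h ≤ 1 →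
      ∀ f₁ f₂ : SchwartzMap (EuclideanSpace ℝ (Fin d)) ℂ,
        HkhNorm d h k (fun x => f₁ x * f₂ x)
          ≤ C * h ^ (-(d : ℝ) / 2) * HkhNorm d h k (⇑f₁) * HkhNorm d h k (⇑f₂) := by
  set J : ℝ := ∫ ξ : EuclideanSpace ℝ (Fin d), ((1 + ‖ξ‖ ^ 2) ^ k)⁻¹ with hJ
  have hJ0 : 0 ≤ J := integral_nonneg fun ξ => by positivity
  refine ⟨Real.sqrt (4 ^ k * (2 * (((2 * Real.pi) ^ d)⁻¹ * J))), ?_⟩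
  intro h hh _ f₁ f₂
  have hpi := Real.pi_pos
  set a : ℝ := 2 * Real.pi * h with ha
  have ha0 : 0 < a := by positivity
  have hsq : h ^ (-(d : ℝ) / 2) = Real.sqrt ((h ^ d)⁻¹) := by
    rw [Real.sqrt_eq_rpow, ← Real.rpow_natCast, ← Real.rpow_neg hh.le, ← Real.rpow_mul hh.le]
    congr 1; ring
  rw [HkhNorm_eq_aux, HkhNorm_eq_aux, HkhNorm_eq_aux, hsq, ← ha]
  set M : SchwartzMap (EuclideanSpace ℝ (Fin d)) ℂ → ℝ := fun F =>
    ∫ ξ : EuclideanSpace ℝ (Fin d), (1 + a ^ 2 * ‖ξ‖ ^ 2) ^ k * ‖F ξ‖ ^ 2 with hM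
  have hM0 : ∀ F, 0 ≤ M F := fun F => integral_nonneg fun ξ => by positivity
  have hN : ∀ f : SchwartzMap (EuclideanSpace ℝ (Fin d)) ℂ,
      (∫ ξ : EuclideanSpace ℝ (Fin d), (1 + a ^ 2 * ‖ξ‖ ^ 2) ^ k * ‖𝓕⁻ (⇑f) ξ‖ ^ 2)
        = M (𝓕⁻ f) := by
    intro f
    simp only [hM, SchwartzMap.fourierInv_coe]
  have hL : ∀ F : SchwartzMap (EuclideanSpace ℝ (Fin d)) ℂ,
      ∫⁻ ξ, ENNReal.ofReal ((1 + a ^ 2 * ‖ξ‖ ^ 2) ^ k) * ‖F ξ‖ₑ ^ 2 = ENNReal.ofReal (M F) := by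
    intro F
    rw [hM, ofReal_integral_eq_lintegral_ofReal (integrable_aux d k a F)
      (Filter.Eventually.of_forall fun ξ => by positivity)]
    congr 1
    ext ξ
    rw [ENNReal.ofReal_mul (by positivity), ENNReal.ofReal_pow (norm_nonneg _), ofReal_norm]
  rw [hN, hN]
  set P := SchwartzMap.pairing (ContinuousLinearMap.mul ℂ ℂ) f₁ f₂ with hP
  have hPf : (fun x => f₁ x * f₂ x) = ⇑P := by
    ext x; simp [hP]
  rw [hPf, hN]
  have main := weighted_conv_aux d k a
    (fun ξ => ENNReal.ofReal ((1 + a ^ 2 * ‖ξ‖ ^ 2) ^ k))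
    (fun ξ => ‖(𝓕⁻ f₁) ξ‖ₑ) (fun ξ => ‖(𝓕⁻ f₂) ξ‖ₑ) (fun _ => rfl)
    (SchwartzMap.continuous _).measurable.enorm (SchwartzMap.continuous _).measurable.enorm
  rw [hL, hL, weight_integral_aux d k hk a ha0, ← hJ] at main
  have main2 : ENNReal.ofReal (M (𝓕⁻ P)) ≤ ENNReal.ofReal
      ((4 ^ k * (2 * ((a ^ d)⁻¹ * J))) * (M (𝓕⁻ f₁) * M (𝓕⁻ f₂))) := by
    rw [← hL, ENNReal.ofReal_mul (by positivity), ENNReal.ofReal_mul (by positivity),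
      ENNReal.ofReal_mul (by norm_num : (0:ℝ) ≤ 2), ENNReal.ofReal_mul (hM0 _),
      ENNReal.ofReal_pow (by norm_num)]
    norm_num only [ENNReal.ofReal_ofNat]
    refine le_trans (lintegral_mono fun ξ => ?_) main
    gcongr
    have := conv_bound_aux d f₁ f₂ ξ
    rwa [hPf, ← SchwartzMap.fourierInv_coe] at this
  have hM1 := hM0 (𝓕⁻ f₁)
  have hM2 := hM0 (𝓕⁻ f₂)
  have main3 := (ENNReal.ofReal_le_ofReal_iff (by positivity)).1 main2
  rw [← Real.sqrt_mul (by positivity), ← Real.sqrt_mul (by positivity),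
    ← Real.sqrt_mul (by positivity)]
  apply Real.sqrt_le_sqrt
  refine main3.trans (le_of_eq ?_)
  rw [ha, mul_pow (2 * Real.pi) h d, mul_inv]
  ring
end
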